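/- Let Ω = (a,b)×(c,d) with a < b and c < d, and let α, γ, β₁, β₂ ∈ ℝ. If v : ℝ² → ℝ is four times continuously differentiable and vanishes on ∂Ω, then ∫_Ω (−α Δv + β₁ v_x + β₂ v_y + γ v) · v_xxyy = α ∫_Ω ((v_xxy)² + (v_xyy)²) + γ ∫_Ω (v_xy)² − ∫_Ω v_xy · (β₁ v_xxy + β₂ v_xyy). -/

import Mathlib

open MeasureTheory Set

/-- Partial derivative with respect to the first variable. -/
noncomputable def pdx (v : ℝ × ℝ → ℝ) : ℝ × ℝ → ℝ :=
  fun p => deriv (fun x => v (x, p.2)) p.1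

/-- Partial derivative with respect to the second variable. -/
noncomputable def pdy (v : ℝ × ℝ → ℝ) : ℝ × ℝ → ℝ :=
  fun p => deriv (fun y => v (p.1, y)) p.2


lemma hasDerivAt_pdx {v : ℝ × ℝ → ℝ} (hv : ContDiff ℝ 1 v) (x y : ℝ) :
    HasDerivAt (fun t => v (t, y)) (pdx v (x, y)) x := by
  have h : DifferentiableAt ℝ (fun t => v (t, y)) x := by
    have := hv.differentiable (by norm_num)
    fun_prop
  exact h.hasDerivAt

lemma hasDerivAt_pdy {v : ℝ × ℝ → ℝ} (hv : ContDiff ℝ 1 v) (x y : ℝ) :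
    HasDerivAt (fun t => v (x, t)) (pdy v (x, y)) y := by
  have h : DifferentiableAt ℝ (fun t => v (x, t)) y := by
    have := hv.differentiable (by norm_num)
    fun_prop
  exact h.hasDerivAt

lemma pdx_eq {v : ℝ × ℝ → ℝ} (hv : ContDiff ℝ 1 v) : pdx v = fun p => fderiv ℝ v p (1, 0) := by
  funext p
  obtain ⟨x, y⟩ := p
  have h1 := (hv.differentiable (by norm_num) (x, y)).hasFDerivAt
  have h2 : HasDerivAt (fun t : ℝ => (t, y)) ((1 : ℝ), (0 : ℝ)) x :=
    (hasDerivAt_id x).prodMk (hasDerivAt_const x y)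
  exact (hasDerivAt_pdx hv x y).unique (h1.comp_hasDerivAt x h2)

lemma pdy_eq {v : ℝ × ℝ → ℝ} (hv : ContDiff ℝ 1 v) : pdy v = fun p => fderiv ℝ v p (0, 1) := by
  funext p
  obtain ⟨x, y⟩ := p
  have h1 := (hv.differentiable (by norm_num) (x, y)).hasFDerivAt
  have h2 : HasDerivAt (fun t : ℝ => (x, t)) ((0 : ℝ), (1 : ℝ)) y :=
    (hasDerivAt_const y x).prodMk (hasDerivAt_id y)
  exact (hasDerivAt_pdy hv x y).unique (h1.comp_hasDerivAt y h2)

lemma contDiff_pdx {v : ℝ × ℝ → ℝ} (n : ℕ) (hv : ContDiff ℝ (n + 1) v) :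
    ContDiff ℝ n (pdx v) := by
  rw [pdx_eq (hv.of_le (by simp))]
  exact (hv.fderiv_right le_rfl).clm_apply contDiff_const

lemma contDiff_pdy {v : ℝ × ℝ → ℝ} (n : ℕ) (hv : ContDiff ℝ (n + 1) v) :
    ContDiff ℝ n (pdy v) := by
  rw [pdy_eq (hv.of_le (by simp))]
  exact (hv.fderiv_right le_rfl).clm_apply contDiff_const

lemma pd_comm {v : ℝ × ℝ → ℝ} (hv : ContDiff ℝ 2 v) : pdx (pdy v) = pdy (pdx v) := by
  have h1 : ContDiff ℝ 1 v := hv.of_le (by norm_num)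
  have hx : ContDiff ℝ 1 (pdx v) := contDiff_pdx 1 (by norm_num; exact hv)
  have hy : ContDiff ℝ 1 (pdy v) := contDiff_pdy 1 (by norm_num; exact hv)
  rw [pdx_eq hy, pdy_eq hx, pdx_eq h1, pdy_eq h1]
  funext p
  have hs : IsSymmSndFDerivAt ℝ v p :=
    hv.contDiffAt.isSymmSndFDerivAt (by simp)
  have hd : DifferentiableAt ℝ (fderiv ℝ v) p :=
    (hv.fderiv_right (m := 1) (by norm_num)).differentiable (by norm_num) p
  rw [fderiv_clm_apply hd (differentiableAt_const _), fderiv_clm_apply hd (differentiableAt_const _)]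
  simpa using hs (1, 0) (0, 1)

lemma integrableOn_rect {f : ℝ × ℝ → ℝ} (hf : Continuous f) (a b c d : ℝ) :
    IntegrableOn f (Ioo a b ×ˢ Ioo c d) :=
  (hf.continuousOn.integrableOn_compact (isCompact_Icc.prod isCompact_Icc)).mono_set
    (prod_mono (Ioo_subset_Icc_self (a := a) (b := b)) (Ioo_subset_Icc_self (a := c) (b := d)))

lemma ibp1 {f g f' g' : ℝ → ℝ} {c d : ℝ} (hcd : c < d) (hf : ∀ y, HasDerivAt f (f' y) y)
    (hg : ∀ y, HasDerivAt g (g' y) y) (cf : Continuous f') (cg : Continuous g')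
    (h1 : f c = 0) (h2 : f d = 0) :
    ∫ y in Ioo c d, f y * g' y = - ∫ y in Ioo c d, f' y * g y := by
  have := intervalIntegral.integral_mul_deriv_eq_deriv_mul (a := c) (b := d)
    (fun x _ => hf x) (fun x _ => hg x) (cf.intervalIntegrable _ _) (cg.intervalIntegrable _ _)
  rw [intervalIntegral.integral_of_le hcd.le, intervalIntegral.integral_of_le hcd.le,
    integral_Ioc_eq_integral_Ioo, integral_Ioc_eq_integral_Ioo] at this
  rw [this, h1, h2]; ring

lemma ibpy {f g : ℝ × ℝ → ℝ} {a b c d : ℝ} (hcd : c < d) (hf : ContDiff ℝ 1 f)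
    (hg : ContDiff ℝ 1 g) (h : ∀ x ∈ Ioo a b, f (x, c) = 0 ∧ f (x, d) = 0) :
    ∫ p in Ioo a b ×ˢ Ioo c d, f p * pdy g p = - ∫ p in Ioo a b ×ˢ Ioo c d, pdy f p * g p := by
  have cf : Continuous (pdy f) := (contDiff_pdy 0 (by simpa using hf)).continuous
  have cg : Continuous (pdy g) := (contDiff_pdy 0 (by simpa using hg)).continuous
  have cf0 := hf.continuous
  have cg0 := hg.continuous
  rw [Measure.volume_eq_prod, setIntegral_prod _ (integrableOn_rect (by fun_prop) a b c d),
    setIntegral_prod _ (integrableOn_rect (by fun_prop) a b c d), ← integral_neg]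
  refine setIntegral_congr_fun measurableSet_Ioo fun x hx => ?_
  exact ibp1 hcd (hasDerivAt_pdy hf x) (hasDerivAt_pdy hg x) (by fun_prop) (by fun_prop)
    (h x hx).1 (h x hx).2

lemma ibpx {f g : ℝ × ℝ → ℝ} {a b c d : ℝ} (hab : a < b) (hf : ContDiff ℝ 1 f)
    (hg : ContDiff ℝ 1 g) (h : ∀ y ∈ Ioo c d, f (a, y) = 0 ∧ f (b, y) = 0) :
    ∫ p in Ioo a b ×ˢ Ioo c d, f p * pdx g p = - ∫ p in Ioo a b ×ˢ Ioo c d, pdx f p * g p := by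
  have cf : Continuous (pdx f) := (contDiff_pdx 0 (by simpa using hf)).continuous
  have cg : Continuous (pdx g) := (contDiff_pdx 0 (by simpa using hg)).continuous
  have cf0 := hf.continuous
  have cg0 := hg.continuous
  have sw : ∀ F : ℝ × ℝ → ℝ, ∫ p in Ioo a b ×ˢ Ioo c d, F p
      = ∫ p in Ioo c d ×ˢ Ioo a b, F p.swap := fun F => by
    rw [Measure.volume_eq_prod]
    exact (setIntegral_prod_swap (μ := volume) (ν := volume) (Ioo a b) (Ioo c d) F).symm
  rw [sw, sw]
  rw [Measure.volume_eq_prod, setIntegral_prod _ (integrableOn_rect (by fun_prop) c d a b),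
    setIntegral_prod _ (integrableOn_rect (by fun_prop) c d a b), ← integral_neg]
  refine setIntegral_congr_fun measurableSet_Ioo fun y hy => ?_
  exact ibp1 hab (fun x => hasDerivAt_pdx hf x y) (fun x => hasDerivAt_pdx hg x y)
    (by fun_prop) (by fun_prop) (h y hy).1 (h y hy).2

lemma pdx_zero {f : ℝ × ℝ → ℝ} {a b c : ℝ} (h : ∀ x ∈ Ioo a b, f (x, c) = 0) :
    ∀ x ∈ Ioo a b, pdx f (x, c) = 0 := fun x hx => by
  have : (fun t => f (t, c)) =ᶠ[nhds x] fun _ => 0 := by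
    filter_upwards [isOpen_Ioo.mem_nhds hx] with t ht using h t ht
  exact this.deriv_eq.trans (deriv_const x 0)

lemma pdy_zero {f : ℝ × ℝ → ℝ} {a b c : ℝ} (h : ∀ x ∈ Ioo a b, f (c, x) = 0) :
    ∀ x ∈ Ioo a b, pdy f (c, x) = 0 := fun x hx => by
  have : (fun t => f (c, t)) =ᶠ[nhds x] fun _ => 0 := by
    filter_upwards [isOpen_Ioo.mem_nhds hx] with t ht using h t ht
  exact this.deriv_eq.trans (deriv_const x 0)

theorem stmt_4 (a b c d : ℝ) (hab : a < b) (hcd : c < d) (α γ β₁ β₂ : ℝ)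
    (v : ℝ × ℝ → ℝ) (hv : ContDiff ℝ 4 v)
    (hbc1 : ∀ x ∈ Icc a b, v (x, c) = 0 ∧ v (x, d) = 0)
    (hbc2 : ∀ y ∈ Icc c d, v (a, y) = 0 ∧ v (b, y) = 0) :
    (∫ p in (Ioo a b) ×ˢ (Ioo c d),
        (-α * (pdx (pdx v) p + pdy (pdy v) p) + β₁ * pdx v p + β₂ * pdy v p + γ * v p) *
          pdx (pdx (pdy (pdy v))) p) =
      α * (∫ p in (Ioo a b) ×ˢ (Ioo c d),
            ((pdx (pdx (pdy v)) p) ^ 2 + (pdx (pdy (pdy v)) p) ^ 2)) +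
        γ * (∫ p in (Ioo a b) ×ˢ (Ioo c d), (pdx (pdy v) p) ^ 2) -
        ∫ p in (Ioo a b) ×ˢ (Ioo c d),
          pdx (pdy v) p * (β₁ * pdx (pdx (pdy v)) p + β₂ * pdx (pdy (pdy v)) p) := by
  have y1 : ∀ x ∈ Ioo a b, v (x, c) = 0 := fun x hx => (hbc1 x (Ioo_subset_Icc_self hx)).1
  have y2 : ∀ x ∈ Ioo a b, v (x, d) = 0 := fun x hx => (hbc1 x (Ioo_subset_Icc_self hx)).2
  have x1 : ∀ y ∈ Ioo c d, v (a, y) = 0 := fun x hx => (hbc2 x (Ioo_subset_Icc_self hx)).1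
  have x2 : ∀ y ∈ Ioo c d, v (b, y) = 0 := fun x hx => (hbc2 x (Ioo_subset_Icc_self hx)).2
  have v1 : ContDiff ℝ 1 v := hv.of_le (by norm_num)
  have v2 : ContDiff ℝ 2 v := hv.of_le (by norm_num)
  have vx : ContDiff ℝ 3 (pdx v) := contDiff_pdx 3 (by norm_num; exact hv)
  have vy : ContDiff ℝ 3 (pdy v) := contDiff_pdy 3 (by norm_num; exact hv)
  have vxx : ContDiff ℝ 2 (pdx (pdx v)) := contDiff_pdx 2 (by norm_num; exact vx)
  have vyy : ContDiff ℝ 2 (pdy (pdy v)) := contDiff_pdy 2 (by norm_num; exact vy)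
  have vxy : ContDiff ℝ 2 (pdx (pdy v)) := contDiff_pdx 2 (by norm_num; exact vy)
  have vA : ContDiff ℝ 1 (pdx (pdx (pdy v))) := contDiff_pdx 1 (by norm_num; exact vxy)
  have vB : ContDiff ℝ 1 (pdx (pdy (pdy v))) := contDiff_pdx 1 (by norm_num; exact vyy)
  have vW : ContDiff ℝ 0 (pdx (pdx (pdy (pdy v)))) := contDiff_pdx 0 (by norm_num; exact vB)
  have e1 : pdy (pdx v) = pdx (pdy v) := (pd_comm v2).symm
  have e2 : pdy (pdx (pdx v)) = pdx (pdx (pdy v)) := by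
    rw [← pd_comm (vx.of_le (by norm_num)), e1]
  have e3 : pdy (pdx (pdx (pdy v))) = pdx (pdx (pdy (pdy v))) := by
    rw [← pd_comm vxy, ← pd_comm (vy.of_le (by norm_num))]
  have I1 := ibpy hcd (vxx.of_le (by norm_num)) vA
    (fun x hx => ⟨pdx_zero (pdx_zero y1) x hx, pdx_zero (pdx_zero y2) x hx⟩)
  have I2 := ibpx hab (vyy.of_le (by norm_num)) vB
    (fun x hx => ⟨pdy_zero (pdy_zero x1) x hx, pdy_zero (pdy_zero x2) x hx⟩)
  have I3 := ibpy hcd (vx.of_le (by norm_num)) vA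
    (fun x hx => ⟨pdx_zero y1 x hx, pdx_zero y2 x hx⟩)
  have I4 := ibpx hab (vy.of_le (by norm_num)) vB
    (fun x hx => ⟨pdy_zero x1 x hx, pdy_zero x2 x hx⟩)
  have I5 := ibpy hcd v1 vA (fun x hx => ⟨y1 x hx, y2 x hx⟩)
  have I6 := ibpx hab (vy.of_le (by norm_num)) (vxy.of_le (by norm_num))
    (fun x hx => ⟨pdy_zero x1 x hx, pdy_zero x2 x hx⟩)
  rw [e3] at I1 I3 I5
  rw [e2] at I1
  rw [e1] at I3
  rw [I6, neg_neg] at I5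
  have c0 := hv.continuous
  have cx := vx.continuous
  have cy := vy.continuous
  have cxx := vxx.continuous
  have cyy := vyy.continuous
  have cxy := vxy.continuous
  have cA := vA.continuous
  have cB := vB.continuous
  have cW := vW.continuous
  clear I6 e1 e2 e3
  generalize pdx (pdx (pdy (pdy v))) = W at *
  generalize pdx (pdx (pdy v)) = A at *
  generalize pdx (pdy (pdy v)) = B at *
  generalize pdx (pdy v) = w at *
  generalize pdx (pdx v) = X at *
  generalize pdy (pdy v) = Y at *
  generalize pdx v = vX at *
  generalize pdy v = vY at *
  have add : ∀ F G : ℝ × ℝ → ℝ, Continuous F → Continuous G →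
      ∫ p in Ioo a b ×ˢ Ioo c d, (F p + G p) =
      (∫ p in Ioo a b ×ˢ Ioo c d, F p) + ∫ p in Ioo a b ×ˢ Ioo c d, G p :=
    fun F G hF hG => integral_add (integrableOn_rect hF a b c d) (integrableOn_rect hG a b c d)
  have L : ∀ p, (-α * (X p + Y p) + β₁ * vX p + β₂ * vY p + γ * v p) * W p =
      -α * (X p * W p) + (-α * (Y p * W p) + (β₁ * (vX p * W p) + (β₂ * (vY p * W p)
        + γ * (v p * W p)))) := fun p => by ring
  have R : ∀ p, w p * (β₁ * A p + β₂ * B p) = β₁ * (w p * A p) + β₂ * (w p * B p) :=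
    fun p => by ring
  simp_rw [L, R]
  rw [add _ _ (by fun_prop) (by fun_prop), add _ _ (by fun_prop) (by fun_prop),
    add _ _ (by fun_prop) (by fun_prop), add _ _ (by fun_prop) (by fun_prop),
    add _ _ (by fun_prop) (by fun_prop), add _ _ (by fun_prop) (by fun_prop)]
  simp only [integral_const_mul, sq]
  rw [I1, I2, I3, I4, I5]
  ring
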